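/- arXiv:2306.01718 — 2 statements merged into one kernel-verified Lean document; each statement's English description precedes it below -/
import Mathlib

section
/- Let F be any field and let T ∈ F^{n1} ⊗ F^{n2} ⊗ F^{n3} be a concise order-three tensor. Then the asymptotic subrank of T satisfies Q~(T) ≥ (min{n1, n2, n3})^(1/3). -/
open scoped BigOperators

namespace Paper

variable {F : Type*} [Field F]

/-- Restriction of order-three tensors: `T ≥ S` iff there exist linear maps
(given by matrices `L1, L2, L3`) carrying `T` to `S`. -/
def Restricts {ι1 ι2 ι3 κ1 κ2 κ3 : Type*} [Fintype ι1] [Fintype ι2] [Fintype ι3]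
    (T : ι1 → ι2 → ι3 → F) (S : κ1 → κ2 → κ3 → F) : Prop :=
  ∃ (L1 : κ1 → ι1 → F) (L2 : κ2 → ι2 → F) (L3 : κ3 → ι3 → F),
    ∀ a b c, S a b c = ∑ i, ∑ j, ∑ k, L1 a i * L2 b j * L3 c k * T i j k

/-- The unit (diagonal) tensor `⟨r⟩`. -/
def unitTensor (F : Type*) [Field F] (r : ℕ) : Fin r → Fin r → Fin r → F :=
  fun i j k => if i = j ∧ j = k then 1 else 0

/-- The subrank `Q(T)`: the largest `r` such that `T` restricts to `⟨r⟩`. -/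
noncomputable def subrank {ι1 ι2 ι3 : Type*} [Fintype ι1] [Fintype ι2] [Fintype ι3]
    (T : ι1 → ι2 → ι3 → F) : ℕ :=
  sSup {r : ℕ | Restricts T (unitTensor F r)}

/-- Kronecker (tensor) power `T^{⊠ m}` of an order-three tensor. -/
def kronPow {ι1 ι2 ι3 : Type*} (T : ι1 → ι2 → ι3 → F) (m : ℕ) :
    (Fin m → ι1) → (Fin m → ι2) → (Fin m → ι3) → F :=
  fun x y z => ∏ s : Fin m, T (x s) (y s) (z s)

/-- Asymptotic subrank `Q~(T) = lim_n Q(T^{⊠n})^{1/n} = sup_n Q(T^{⊠n})^{1/n}`. -/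
noncomputable def asympSubrank {ι1 ι2 ι3 : Type*} [Fintype ι1] [Fintype ι2] [Fintype ι3]
    (T : ι1 → ι2 → ι3 → F) : ℝ :=
  ⨆ m : ℕ, (subrank (kronPow T (m + 1)) : ℝ) ^ ((1 : ℝ) / (m + 1))

/-- First flattening of a tensor. -/
def flattening1 {ι1 ι2 ι3 : Type*} (T : ι1 → ι2 → ι3 → F) : Matrix ι1 (ι2 × ι3) F :=
  Matrix.of fun i p => T i p.1 p.2

/-- Second flattening of a tensor. -/
def flattening2 {ι1 ι2 ι3 : Type*} (T : ι1 → ι2 → ι3 → F) : Matrix ι2 (ι1 × ι3) F :=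
  Matrix.of fun j p => T p.1 j p.2

/-- Third flattening of a tensor. -/
def flattening3 {ι1 ι2 ι3 : Type*} (T : ι1 → ι2 → ι3 → F) : Matrix ι3 (ι1 × ι2) F :=
  Matrix.of fun k p => T p.1 p.2 k

/-- A tensor is concise if all three flattening ranks are maximal. -/
noncomputable def Concise {ι1 ι2 ι3 : Type*} [Fintype ι1] [Fintype ι2] [Fintype ι3]
    (T : ι1 → ι2 → ι3 → F) : Prop :=
  (flattening1 T).rank = Fintype.card ι1 ∧
  (flattening2 T).rank = Fintype.card ι2 ∧
  (flattening3 T).rank = Fintype.card ι3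

/-- A tensor has slice rank one if one of its flattenings has rank one. -/
noncomputable def SliceRankOne {ι1 ι2 ι3 : Type*} [Fintype ι1] [Fintype ι2] [Fintype ι3]
    (T : ι1 → ι2 → ι3 → F) : Prop :=
  (flattening1 T).rank = 1 ∨ (flattening2 T).rank = 1 ∨ (flattening3 T).rank = 1

/-- The slice rank `SR(T)`: the least `r` such that `T` is a sum of `r` slice-rank-one
tensors. -/
noncomputable def sliceRank {ι1 ι2 ι3 : Type*} [Fintype ι1] [Fintype ι2] [Fintype ι3]
    (T : ι1 → ι2 → ι3 → F) : ℕ :=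
  sInf {r : ℕ | ∃ f : Fin r → (ι1 → ι2 → ι3 → F),
    (∀ t, SliceRankOne (f t)) ∧ T = ∑ t, f t}

/-- The liminf-asymptotic slice rank. -/
noncomputable def asympSliceRankInf {ι1 ι2 ι3 : Type*} [Fintype ι1] [Fintype ι2] [Fintype ι3]
    (T : ι1 → ι2 → ι3 → F) : ℝ :=
  Filter.liminf (fun m : ℕ => (sliceRank (kronPow T m) : ℝ) ^ ((1 : ℝ) / m)) Filter.atTop

/-- The limsup-asymptotic slice rank. -/
noncomputable def asympSliceRankSup {ι1 ι2 ι3 : Type*} [Fintype ι1] [Fintype ι2] [Fintype ι3]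
    (T : ι1 → ι2 → ι3 → F) : ℝ :=
  Filter.limsup (fun m : ℕ => (sliceRank (kronPow T m) : ℝ) ^ ((1 : ℝ) / m)) Filter.atTop

/-- The max-rank of a matrix subspace. -/
noncomputable def maxrank {m n : Type*} [Fintype n] (𝒜 : Submodule F (Matrix m n F)) : ℕ :=
  sSup {r : ℕ | ∃ A ∈ 𝒜, A.rank = r}

/-- The min-rank of a matrix subspace: the least rank of a nonzero element. -/
noncomputable def minrank {m n : Type*} [Fintype n] (𝒜 : Submodule F (Matrix m n F)) : ℕ :=
  sInf {r : ℕ | ∃ A ∈ 𝒜, A ≠ 0 ∧ A.rank = r}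

section Slices

variable {n1 n2 n3 : ℕ}

/-- Span of the 3-slices, rows indexed by direction 1, columns by direction 2. -/
def span12 (T : Fin n1 → Fin n2 → Fin n3 → F) : Submodule F (Matrix (Fin n1) (Fin n2) F) :=
  Submodule.span F (Set.range fun k : Fin n3 => Matrix.of fun i j => T i j k)

/-- Span of the 3-slices, rows indexed by direction 2, columns by direction 1. -/
def span21 (T : Fin n1 → Fin n2 → Fin n3 → F) : Submodule F (Matrix (Fin n2) (Fin n1) F) :=
  Submodule.span F (Set.range fun k : Fin n3 => Matrix.of fun j i => T i j k)

/-- Span of the 2-slices, rows indexed by direction 1, columns by direction 3. -/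
def span13 (T : Fin n1 → Fin n2 → Fin n3 → F) : Submodule F (Matrix (Fin n1) (Fin n3) F) :=
  Submodule.span F (Set.range fun j : Fin n2 => Matrix.of fun i k => T i j k)

/-- Span of the 2-slices, rows indexed by direction 3, columns by direction 1. -/
def span31 (T : Fin n1 → Fin n2 → Fin n3 → F) : Submodule F (Matrix (Fin n3) (Fin n1) F) :=
  Submodule.span F (Set.range fun j : Fin n2 => Matrix.of fun k i => T i j k)

/-- Span of the 1-slices, rows indexed by direction 2, columns by direction 3. -/
def span23 (T : Fin n1 → Fin n2 → Fin n3 → F) : Submodule F (Matrix (Fin n2) (Fin n3) F) :=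
  Submodule.span F (Set.range fun i : Fin n1 => Matrix.of fun j k => T i j k)

/-- Span of the 1-slices, rows indexed by direction 3, columns by direction 2. -/
def span32 (T : Fin n1 → Fin n2 → Fin n3 → F) : Submodule F (Matrix (Fin n3) (Fin n2) F) :=
  Submodule.span F (Set.range fun i : Fin n1 => Matrix.of fun k j => T i j k)

/-- `Q_1(T)`: max-rank of the span of the 1-slices. -/
noncomputable def Q1 (T : Fin n1 → Fin n2 → Fin n3 → F) : ℕ := maxrank (span23 T)

/-- `Q_2(T)`: max-rank of the span of the 2-slices. -/
noncomputable def Q2 (T : Fin n1 → Fin n2 → Fin n3 → F) : ℕ := maxrank (span13 T)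

/-- `Q_3(T)`: max-rank of the span of the 3-slices. -/
noncomputable def Q3 (T : Fin n1 → Fin n2 → Fin n3 → F) : ℕ := maxrank (span12 T)

end Slices

/-- `p` is the pivot of the matrix `A`: the lexicographically least position of a
nonzero entry. -/
def IsPivot {n1 n2 : ℕ} (A : Matrix (Fin n1) (Fin n2) F) (p : Fin n1 × Fin n2) : Prop :=
  A p.1 p.2 ≠ 0 ∧ ∀ q : Fin n1 × Fin n2, A q.1 q.2 ≠ 0 → p.1 < q.1 ∨ (p.1 = q.1 ∧ p.2 ≤ q.2)

/-- The set of pivots of a matrix subspace (equal to the pivots of any basis with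
pairwise distinct pivots). -/
def pivotSet {n1 n2 : ℕ} (𝒜 : Submodule F (Matrix (Fin n1) (Fin n2) F)) :
    Set (Fin n1 × Fin n2) :=
  {p | ∃ A ∈ 𝒜, IsPivot A p}

/-- `ρ(𝒜)`: the least `r = |S1| + |S2|` such that the pivots of `𝒜` are covered by the
rows `S1` and columns `S2`. -/
noncomputable def rho {n1 n2 : ℕ} (𝒜 : Submodule F (Matrix (Fin n1) (Fin n2) F)) : ℕ :=
  sInf {r : ℕ | ∃ (S1 : Finset (Fin n1)) (S2 : Finset (Fin n2)),
    S1.card + S2.card = r ∧ ∀ p ∈ pivotSet 𝒜, p.1 ∈ S1 ∨ p.2 ∈ S2}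

/-- The border subrank `Q̲(T)`: the largest `r` such that, over Laurent polynomials
in `ε`, some restriction of `T` equals `⟨r⟩ + ε S_1 + ⋯ + ε^t S_t`. -/
noncomputable def borderSubrank {ι1 ι2 ι3 : Type*} [Fintype ι1] [Fintype ι2] [Fintype ι3]
    (T : ι1 → ι2 → ι3 → F) : ℕ :=
  sSup {r : ℕ |
    ∃ (A : Fin r → ι1 → LaurentPolynomial F) (B : Fin r → ι2 → LaurentPolynomial F)
      (C : Fin r → ι3 → LaurentPolynomial F) (t : ℕ)
      (S : Fin t → (Fin r → Fin r → Fin r → F)),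
      ∀ a b c,
        (∑ i, ∑ j, ∑ k, A a i * B b j * C c k * LaurentPolynomial.C (T i j k)) =
          LaurentPolynomial.C (unitTensor F r a b c) +
            ∑ s : Fin t, LaurentPolynomial.T (((s : ℕ) : ℤ) + 1) *
              LaurentPolynomial.C (S s a b c)}

/-- The linear map `A ↦ U * A * V` on rectangular matrices. -/
def conjMap {n1 n2 : ℕ} (U : Matrix (Fin n1) (Fin n1) F) (V : Matrix (Fin n2) (Fin n2) F) :
    Matrix (Fin n1) (Fin n2) F →ₗ[F] Matrix (Fin n1) (Fin n2) F where
  toFun A := U * A * V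
  map_add' A B := by simp [Matrix.mul_add, Matrix.add_mul]
  map_smul' c A := by simp [Matrix.mul_smul, Matrix.smul_mul]

/-- The principal submatrix `A_{J×J}`, where `J ⊆ [min{n1,n2}]` is encoded by the
map `η`. -/
def restrictJJ {n1 n2 jn : ℕ} (η : Fin jn → Fin (min n1 n2))
    (A : Matrix (Fin n1) (Fin n2) F) : Matrix (Fin jn) (Fin jn) F :=
  Matrix.of fun p q =>
    A (Fin.castLE (min_le_left n1 n2) (η p)) (Fin.castLE (min_le_right n1 n2) (η q))

/-- An order-three tensor over `F` of arbitrary format. -/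
structure Tensor3 (F : Type*) [Field F] where
  n1 : ℕ
  n2 : ℕ
  n3 : ℕ
  coef : Fin n1 → Fin n2 → Fin n3 → F

/-- Two tensors are equivalent if each restricts to the other. -/
def Tensor3.Equivalent (T S : Tensor3 F) : Prop :=
  Restricts T.coef S.coef ∧ Restricts S.coef T.coef

/-- A rank-one order-`k` tensor: a tensor product of `k` nonzero vectors. -/
def RankOne {k : ℕ} {ι : Fin k → Type*} (T : ((i : Fin k) → ι i) → F) : Prop :=
  ∃ u : (i : Fin k) → (ι i → F), (∀ i, u i ≠ 0) ∧ ∀ v, T v = ∏ i, u i (v i)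

/-- The tensor rank of an order-`k` tensor. -/
noncomputable def tensorRank {k : ℕ} {ι : Fin k → Type*} (T : ((i : Fin k) → ι i) → F) : ℕ :=
  sInf {r : ℕ | ∃ f : Fin r → (((i : Fin k) → ι i) → F),
    (∀ t, RankOne (f t)) ∧ T = ∑ t, f t}

/-- Kronecker power of an order-`k` tensor. -/
def kronPowK {k : ℕ} {ι : Fin k → Type*} (T : ((i : Fin k) → ι i) → F) (m : ℕ) :
    ((i : Fin k) → (Fin m → ι i)) → F :=
  fun v => ∏ s : Fin m, T fun i => v i s

/-- The asymptotic rank `R~(T) = lim_n R(T^{⊠n})^{1/n} = inf_n R(T^{⊠n})^{1/n}`. -/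
noncomputable def asympRank {k : ℕ} {ι : Fin k → Type*} (T : ((i : Fin k) → ι i) → F) : ℝ :=
  ⨅ m : ℕ, (tensorRank (kronPowK T (m + 1)) : ℝ) ^ ((1 : ℝ) / (m + 1))

section Bilinear

open Module Submodule

variable {X Y : Type*} [AddCommGroup X] [Module F X] [AddCommGroup Y] [Module F Y]

theorem finrank_finset_sup_le {ι Z : Type*} [AddCommGroup Z] [Module F Z] [FiniteDimensional F Z]
    (t : Finset ι) (p : ι → Submodule F Z) (s : ℕ) (hp : ∀ i, finrank F (p i) ≤ s) :
    finrank F (t.sup p : Submodule F Z) ≤ t.card * s := by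
  classical
  induction t using Finset.induction_on with
  | empty => simp
  | insert a t ha ih =>
    rw [Finset.sup_insert, Finset.card_insert_of_notMem ha]
    have := finrank_add_le_finrank_add_finrank (p a) (t.sup p)
    have := hp a
    linarith

theorem finrank_add_finrank_map_mkQ_le {Z : Type*} [AddCommGroup Z] [Module F Z]
    [FiniteDimensional F Z] {P U W : Submodule F Z} (hPU : P ≤ U) (hPW : P ≤ W) :
    finrank F P + finrank F (U.map W.mkQ) ≤ finrank F U := by
  have h := LinearMap.finrank_range_add_finrank_ker (W.mkQ.domRestrict U)
  rw [LinearMap.range_domRestrict] at h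
  have hker : P.comap U.subtype ≤ LinearMap.ker (W.mkQ.domRestrict U) := fun z hz => by
    simpa using hPW hz
  have h1 := finrank_mono hker
  rw [(comapSubtypeEquivOfLe hPU).finrank_eq] at h1
  omega

theorem exists_preimages_range {Z : Type*} [AddCommGroup Z] [Module F Z] [FiniteDimensional F Z]
    (f : Y →ₗ[F] Z) {r : ℕ} (hr : finrank F (LinearMap.range f) = r) :
    ∃ y : Fin r → Y, (span F (Set.range y)).map f = LinearMap.range f ∧
      LinearIndependent F (f ∘ y) := by
  let b := finBasisOfFinrankEq F (LinearMap.range f) hr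
  choose y hy using fun i => (b i).2
  have hfy : f ∘ y = (LinearMap.range f).subtype ∘ b := funext hy
  refine ⟨y, ?_, ?_⟩
  · rw [map_span, ← Set.range_comp, hfy, Set.range_comp, ← map_span, b.span_eq]
    simp
  · rw [hfy]
    exact b.linearIndependent.map' _ (ker_subtype _)

/-- If all partial evaluations of a bilinear map have rank at most `r` and `s` respectively,
then its image spans a space of dimension at most `2 * r * s`. -/
theorem finrank_iSup_range_le {Z : Type*} [AddCommGroup Z] [Module F Z] [FiniteDimensional F Z]
    (s r : ℕ) (v : X →ₗ[F] Y →ₗ[F] Z)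
    (hr : ∀ x, finrank F (LinearMap.range (v x)) ≤ r)
    (hs : ∀ y, finrank F (LinearMap.range (v.flip y)) ≤ s) :
    finrank F (⨆ x, LinearMap.range (v x) : Submodule F Z) ≤ 2 * r * s := by
  induction r using Nat.strong_induction_on generalizing Z with
  | _ r ih =>
  obtain rfl | hr0 := Nat.eq_zero_or_pos r
  · have : (⨆ x, LinearMap.range (v x) : Submodule F Z) = ⊥ := by
      refine iSup_eq_bot.2 fun x => ?_
      exact finrank_eq_zero.1 (Nat.le_zero.1 (hr x))
    simp [this]
  by_cases hx : ∃ x, finrank F (LinearMap.range (v x)) = r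
  swap
  · push Not at hx
    refine (ih (r - 1) (by omega) v (fun x => ?_) hs).trans ?_
    · have := hr x
      have := hx x
      omega
    · gcongr
      omega
  obtain ⟨x₀, hx₀⟩ := hx
  obtain ⟨y, hy, -⟩ := exists_preimages_range (v x₀) hx₀
  set Y₀ := span F (Set.range y)
  set W : Submodule F Z := Finset.univ.sup fun j => LinearMap.range (v.flip (y j)) with hW
  have hWdim : finrank F W ≤ r * s := by
    simpa using finrank_finset_sup_le Finset.univ (fun j => LinearMap.range (v.flip (y j))) s
      (fun j => hs _)
  have hmem : ∀ x, Y₀.map (v x) ≤ W := fun x => by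
    rw [map_span_le]
    rintro _ ⟨j, rfl⟩
    exact Finset.le_sup (f := fun j => LinearMap.range (v.flip (y j))) (Finset.mem_univ j)
      ⟨x, rfl⟩
  set v' : X →ₗ[F] Y →ₗ[F] Z ⧸ W := v.compr₂ W.mkQ with hv'
  have hrange : ∀ x, LinearMap.range (v' x) = (LinearMap.range (v x)).map W.mkQ := fun x =>
    LinearMap.range_comp _ _
  have hzero : v' x₀ = 0 := by
    rw [← LinearMap.range_eq_bot, hrange, ← hy, ← le_bot_iff]
    refine (map_mono (hmem x₀)).trans ?_
    simp
  have hr' : ∀ x, finrank F (LinearMap.range (v' x)) ≤ r / 2 := fun x => by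
    have h1 := finrank_add_finrank_map_mkQ_le (LinearMap.map_le_range (f := v x) (p := Y₀))
      (hmem x)
    have h2 := finrank_add_finrank_map_mkQ_le
      (LinearMap.map_le_range (f := v (x + x₀)) (p := Y₀)) (hmem _)
    rw [← hrange] at h1 h2
    rw [map_add v', hzero, add_zero] at h2
    have h3 : LinearMap.range (v x₀) ≤ Y₀.map (v x) ⊔ Y₀.map (v (x + x₀)) := by
      rw [← hy]
      rintro _ ⟨z, hz, rfl⟩
      have : v x₀ z = v (x + x₀) z - v x z := by simp
      rw [this]
      exact sub_mem (mem_sup_right (mem_map_of_mem hz)) (mem_sup_left (mem_map_of_mem hz))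
    have h4 := (finrank_mono h3).trans (finrank_add_le_finrank_add_finrank _ _)
    have h5 := hr x
    have h6 := hr (x + x₀)
    omega
  have hs' : ∀ y, finrank F (LinearMap.range (v'.flip y)) ≤ s := fun y => by
    have : v'.flip y = W.mkQ ∘ₗ v.flip y := rfl
    rw [this, LinearMap.range_comp]
    exact (finrank_map_le _ _).trans (hs y)
  have key := ih (r / 2) (by omega) v' hr' hs'
  have hle : finrank F (⨆ x, LinearMap.range (v x) : Submodule F Z) ≤
      finrank F ((⨆ x, LinearMap.range (v x) : Submodule F Z).map W.mkQ) + finrank F W := by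
    set U : Submodule F Z := ⨆ x, LinearMap.range (v x)
    have h := LinearMap.finrank_range_add_finrank_ker (W.mkQ.domRestrict U)
    rw [LinearMap.range_domRestrict] at h
    have h1 : (LinearMap.ker (W.mkQ.domRestrict U)).map U.subtype ≤ W := by
      rintro _ ⟨z, hz, rfl⟩
      simpa using hz
    have h2 := finrank_mono h1
    rw [finrank_map_subtype_eq] at h2
    omega
  rw [Submodule.map_iSup, ← iSup_congr hrange] at hle
  have : 2 * (r / 2) * s ≤ r * s := by
    gcongr
    omega
  linarith

end Bilinear

section Triangle

/-- Three labelings of `ι` such that the edges they span contain no triangles besides the obvious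
ones. -/
def TriangleFree {ι α β γ : Type*} (f : ι → α) (g : ι → β) (h : ι → γ) : Prop :=
  ∀ d d' d'', h d = h d' → f d' = f d'' → g d'' = g d → d = d' ∧ d' = d''

theorem TriangleFree.rotate {ι α β γ : Type*} {f : ι → α} {g : ι → β} {h : ι → γ}
    (H : TriangleFree f g h) : TriangleFree g h f := by
  intro d d' d'' h1 h2 h3
  obtain ⟨rfl, rfl⟩ := H d'' d d' h3 h1 h2
  exact ⟨rfl, rfl⟩

theorem TriangleFree.swap {ι α β γ : Type*} {f : ι → α} {g : ι → β} {h : ι → γ}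
    (H : TriangleFree f g h) : TriangleFree f h g := by
  intro d d' d'' h1 h2 h3
  obtain ⟨rfl, rfl⟩ := H d d'' d' h3.symm h2.symm h1.symm
  exact ⟨rfl, rfl⟩

theorem exists_triangleFree_of_sorted {a b c : ℕ} (hbc : b ≤ c) (hab : a ≤ b) :
    ∃ (f : Fin ((a + 2) / 3 * rothNumberNat ((b + 2) / 3)) → Fin a)
      (g : Fin ((a + 2) / 3 * rothNumberNat ((b + 2) / 3)) → Fin b)
      (h : Fin ((a + 2) / 3 * rothNumberNat ((b + 2) / 3)) → Fin c), TriangleFree f g h := by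
  obtain ⟨S, hSub, hcard, hS⟩ := rothNumberNat_spec ((b + 2) / 3)
  let e : Fin ((a + 2) / 3 * rothNumberNat ((b + 2) / 3)) ≃ Fin ((a + 2) / 3) × S :=
    (Fintype.equivFinOfCardEq (by simp [hcard])).symm
  have hlt : ∀ d, ((e d).2 : ℕ) < (b + 2) / 3 := fun d =>
    Finset.mem_range.1 (hSub (e d).2.2)
  refine ⟨fun d => ⟨(e d).1, by omega⟩, fun d => ⟨(e d).1 + (e d).2, ?_⟩,
    fun d => ⟨(e d).1 + 2 * (e d).2, ?_⟩, ?_⟩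
  · have := hlt d
    omega
  · have := hlt d
    omega
  · intro d d' d'' h1 h2 h3
    simp only [Fin.mk.injEq] at h1 h2 h3
    have h4 : ((e d'').2 : ℕ) = (e d').2 :=
      hS (e d'').2.2 (e d').2.2 (e d).2.2 (by omega)
    refine ⟨e.injective (Prod.ext (Fin.ext ?_) (Subtype.ext ?_)),
      e.injective (Prod.ext (Fin.ext ?_) (Subtype.ext ?_))⟩ <;> omega

theorem le_mul_rothNumberNat {a b : ℕ} {B M : ℝ} (hbB : (b : ℝ) ≤ B) (hM : M ≤ 2 * a * b) :
    M / 18 * Real.exp (-4 * √(Real.log B)) ≤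
      ((a + 2) / 3 * rothNumberNat ((b + 2) / 3) : ℕ) := by
  obtain rfl | hb0 := Nat.eq_zero_or_pos b
  · have : M / 18 ≤ 0 := by simp at hM; linarith
    exact (mul_nonpos_of_nonpos_of_nonneg this (Real.exp_pos _).le).trans (Nat.cast_nonneg _)
  have ha' : (a : ℝ) / 3 ≤ ((a + 2) / 3 : ℕ) := by
    rw [div_le_iff₀ (by norm_num)]
    norm_cast
    omega
  have hb' : (b : ℝ) / 3 ≤ ((b + 2) / 3 : ℕ) := by
    rw [div_le_iff₀ (by norm_num)]
    norm_cast
    omega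
  have hpos : (0 : ℝ) < ((b + 2) / 3 : ℕ) := by
    norm_cast
    omega
  have hle : (((b + 2) / 3 : ℕ) : ℝ) ≤ B := by
    refine le_trans ?_ hbB
    norm_cast
    omega
  calc M / 18 * Real.exp (-4 * √(Real.log B))
      ≤ (a / 3) * ((b / 3) * Real.exp (-4 * √(Real.log B))) := by
        rw [← mul_assoc]
        gcongr
        linarith
    _ ≤ ((a + 2) / 3 : ℕ) * (((b + 2) / 3 : ℕ) *
          Real.exp (-4 * √(Real.log ((b + 2) / 3 : ℕ)))) := by
        have h1 : Real.exp (-4 * √(Real.log B)) ≤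
            Real.exp (-4 * √(Real.log ((b + 2) / 3 : ℕ))) := by
          have := Real.sqrt_le_sqrt (Real.log_le_log hpos hle)
          exact Real.exp_le_exp.2 (by linarith)
        gcongr
    _ ≤ _ := by
        push_cast
        gcongr
        exact_mod_cast Behrend.roth_lower_bound

theorem exists_triangleFree {a b c : ℕ} {B M : ℝ} (ha : (a : ℝ) ≤ B) (hb : (b : ℝ) ≤ B)
    (hc : (c : ℝ) ≤ B) (hab : M ≤ 2 * a * b) (hbc : M ≤ 2 * b * c) (hca : M ≤ 2 * c * a) :
    ∃ (r : ℕ) (f : Fin r → Fin a) (g : Fin r → Fin b) (h : Fin r → Fin c),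
      TriangleFree f g h ∧ M / 18 * Real.exp (-4 * √(Real.log B)) ≤ r := by
  have hba : M ≤ 2 * b * a := by linarith
  have hcb : M ≤ 2 * c * b := by linarith
  have hac : M ≤ 2 * a * c := by linarith
  rcases le_total a b with h1 | h1 <;> rcases le_total b c with h2 | h2 <;>
    rcases le_total a c with h3 | h3
  · obtain ⟨f, g, h, H⟩ := exists_triangleFree_of_sorted h2 h1
    exact ⟨_, f, g, h, H, le_mul_rothNumberNat hb hab⟩
  · obtain ⟨f, g, h, H⟩ := exists_triangleFree_of_sorted h2 h1
    exact ⟨_, f, g, h, H, le_mul_rothNumberNat hb hab⟩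
  · obtain ⟨f, g, h, H⟩ := exists_triangleFree_of_sorted h2 h3
    exact ⟨_, f, h, g, H.swap, le_mul_rothNumberNat hc hac⟩
  · obtain ⟨f, g, h, H⟩ := exists_triangleFree_of_sorted h1 h3
    exact ⟨_, g, h, f, H.rotate, le_mul_rothNumberNat ha hca⟩
  · obtain ⟨f, g, h, H⟩ := exists_triangleFree_of_sorted h3 h1
    exact ⟨_, g, f, h, H.swap.rotate.rotate, le_mul_rothNumberNat ha hba⟩
  · obtain ⟨f, g, h, H⟩ := exists_triangleFree_of_sorted h3 h2
    exact ⟨_, h, f, g, H.rotate.rotate, le_mul_rothNumberNat hc hbc⟩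
  · obtain ⟨f, g, h, H⟩ := exists_triangleFree_of_sorted h1 h2
    exact ⟨_, h, g, f, H.swap.rotate, le_mul_rothNumberNat hb hcb⟩
  · obtain ⟨f, g, h, H⟩ := exists_triangleFree_of_sorted h1 h2
    exact ⟨_, h, g, f, H.swap.rotate, le_mul_rothNumberNat hb hcb⟩

end Triangle

section RightInverse

variable {m n : Type*} [Fintype m] [Fintype n]

theorem rank_eq_card_iff_exists_mul_eq_one [DecidableEq m] (A : Matrix m n F) :
    A.rank = Fintype.card m ↔ ∃ B : Matrix n m F, A * B = 1 := by
  constructor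
  · intro h
    rw [← Matrix.mulVec_surjective_iff_exists_right_inverse]
    refine LinearMap.range_eq_top.1 (Submodule.eq_top_of_finrank_eq
      (S := LinearMap.range A.mulVecLin) ?_)
    rw [Module.finrank_fintype_fun_eq_card]
    exact h
  · rintro ⟨B, hB⟩
    refine le_antisymm A.rank_le_card_height ?_
    have := Matrix.rank_mul_le_left A B
    rwa [hB, Matrix.rank_one] at this

theorem exists_mul_mul_eq_one (M : Matrix m n F) :
    ∃ (P : Matrix (Fin M.rank) m F) (Q : Matrix n (Fin M.rank) F), P * M * Q = 1 := by
  obtain ⟨y, -, hy⟩ := exists_preimages_range M.mulVecLin (r := M.rank) rfl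
  let Q : Matrix n (Fin M.rank) F := (Matrix.of y).transpose
  have hrow : LinearIndependent F (M * Q).transpose.row := by
    have : (M * Q).transpose.row = M.mulVecLin ∘ y := by
      ext i j
      simp [Q, Matrix.mul_apply, Matrix.mulVec, dotProduct, mul_comm]
    rw [this]
    exact hy
  obtain ⟨B, hB⟩ := (rank_eq_card_iff_exists_mul_eq_one (M * Q).transpose).1 hrow.rank_matrix
  refine ⟨B.transpose, Q, ?_⟩
  rw [Matrix.mul_assoc, ← Matrix.transpose_inj, Matrix.transpose_mul, Matrix.transpose_transpose,
    hB, Matrix.transpose_one]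

end RightInverse

section Tensors

variable {ι1 ι2 ι3 κ1 κ2 κ3 : Type*}

/-- Cyclic rotation of the legs of a tensor. -/
def rotate (T : ι1 → ι2 → ι3 → F) : ι2 → ι3 → ι1 → F := fun j k i => T i j k

/-- Contraction of the first leg of a tensor with a vector. -/
def contract [Fintype ι1] (T : ι1 → ι2 → ι3 → F) (x : ι1 → F) : Matrix ι2 ι3 F :=
  Matrix.of fun j k => ∑ i, x i * T i j k

/-- Kronecker product of tensors. -/
def kron (T : ι1 → ι2 → ι3 → F) (S : κ1 → κ2 → κ3 → F) :
    ι1 × κ1 → ι2 × κ2 → ι3 × κ3 → F :=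
  fun p q r => T p.1 q.1 r.1 * S p.2 q.2 r.2

variable [Fintype ι1] [Fintype ι2] [Fintype ι3]

theorem card_le_of_rank_contract_le (T : ι1 → ι2 → ι3 → F)
    (hT : (flattening3 T).rank = Fintype.card ι3) {r s : ℕ}
    (hr : ∀ x, (contract T x).rank ≤ r) (hs : ∀ y, (contract (rotate T) y).rank ≤ s) :
    Fintype.card ι3 ≤ 2 * r * s := by
  classical
  let v : (ι1 → F) →ₗ[F] (ι2 → F) →ₗ[F] (ι3 → F) :=
    LinearMap.mk₂ F (fun x y => (contract T x).transpose.mulVec y)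
      (fun x x' y => by
        rw [← Matrix.add_mulVec]
        congr 1
        ext k j
        simp [contract, add_mul, Finset.sum_add_distrib])
      (fun c x y => by
        rw [← Matrix.smul_mulVec]
        congr 1
        ext k j
        simp [contract, Finset.mul_sum, mul_assoc])
      (fun x y y' => Matrix.mulVec_add _ _ _)
      (fun c x y => Matrix.mulVec_smul _ _ _)
  have hflip : ∀ y, v.flip y = (contract (rotate T) y).mulVecLin := fun y => by
    ext x k
    simp [v, contract, rotate, Matrix.mulVec, dotProduct, Finset.mul_sum,
      Pi.single_apply, mul_comm]
  have key := finrank_iSup_range_le s r v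
    (fun x => (Matrix.rank_transpose (contract T x)).trans_le (hr x))
    (fun y => by rw [hflip]; exact hs y)
  have htop : (⨆ x, LinearMap.range (v x) : Submodule F (ι3 → F)) = ⊤ := by
    rw [eq_top_iff]
    rintro z -
    obtain ⟨B, hB⟩ := (rank_eq_card_iff_exists_mul_eq_one _).1 hT
    have hz : z = ∑ p : ι1 × ι2, B.mulVec z p • v (Pi.single p.1 1) (Pi.single p.2 1) := by
      have h1 : z = (flattening3 T).mulVec (B.mulVec z) := by
        rw [Matrix.mulVec_mulVec, hB, Matrix.one_mulVec]
      conv_lhs => rw [h1]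
      ext k
      rw [Matrix.mulVec, dotProduct, Finset.sum_apply]
      refine Finset.sum_congr rfl fun p _ => ?_
      simp [v, contract, flattening3, Pi.single_apply, mul_comm]
    rw [hz]
    exact Submodule.sum_mem _ fun p _ => Submodule.smul_mem _ _
      (le_iSup (fun x => LinearMap.range (v x)) _ ⟨_, rfl⟩)
  rwa [htop, finrank_top, Module.finrank_fintype_fun_eq_card] at key

theorem rank_flattening3_kronPow (T : ι1 → ι2 → ι3 → F)
    (hT : (flattening3 T).rank = Fintype.card ι3) (m : ℕ) :
    (flattening3 (kronPow T m)).rank = Fintype.card (Fin m → ι3) := by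
  classical
  rw [rank_eq_card_iff_exists_mul_eq_one] at hT ⊢
  obtain ⟨B, hB⟩ := hT
  refine ⟨Matrix.of fun p z => ∏ s, B (p.1 s, p.2 s) (z s), ?_⟩
  ext z z'
  have h : ∀ s, ∑ p, T p.1 p.2 (z s) * B p (z' s) = if z s = z' s then 1 else 0 := fun s => by
    have := congrFun (congrFun hB (z s)) (z' s)
    rwa [Matrix.mul_apply, Matrix.one_apply] at this
  rw [Matrix.mul_apply, Matrix.one_apply]
  calc _ = ∑ w : Fin m → ι1 × ι2, ∏ s, (T (w s).1 (w s).2 (z s) * B (w s) (z' s)) := by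
        rw [← (Equiv.arrowProdEquivProdArrow (Fin m) (fun _ => ι1) (fun _ => ι2)).sum_comp]
        simp [flattening3, kronPow, Finset.prod_mul_distrib, Equiv.arrowProdEquivProdArrow]
    _ = ∏ s, ∑ p, T p.1 p.2 (z s) * B p (z' s) := by rw [Fintype.prod_sum]
    _ = _ := by
        simp_rw [h, Finset.prod_ite_zero, funext_iff]
        simp

theorem Restricts.comp {T : ι1 → ι2 → ι3 → F} {S : κ1 → κ2 → κ3 → F} (h : Restricts T S)
    {μ1 μ2 μ3 : Type*} (u : μ1 → κ1) (v : μ2 → κ2) (w : μ3 → κ3) :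
    Restricts T fun a b c => S (u a) (v b) (w c) := by
  obtain ⟨L1, L2, L3, hL⟩ := h
  exact ⟨L1 ∘ u, L2 ∘ v, L3 ∘ w, fun a b c => hL _ _ _⟩

theorem Restricts.of_rotate {T : ι1 → ι2 → ι3 → F} {S : κ2 → κ3 → κ1 → F}
    (h : Restricts (rotate T) S) : Restricts T fun a b c => S b c a := by
  obtain ⟨L2, L3, L1, hL⟩ := h
  refine ⟨L1, L2, L3, fun a b c => ?_⟩
  refine (hL b c a).trans ?_
  simp_rw [Finset.sum_comm (γ := ι1)]
  refine Finset.sum_congr rfl fun i _ => Finset.sum_congr rfl fun j _ =>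
    Finset.sum_congr rfl fun k _ => ?_
  rw [rotate]
  ring

theorem restricts_of_contract (T : ι1 → ι2 → ι3 → F) (x : ι1 → F) :
    Restricts T fun (_ : Unit) (l l' : Fin (contract T x).rank) =>
      if l = l' then (1 : F) else 0 := by
  obtain ⟨P, Q, hPQ⟩ := exists_mul_mul_eq_one (contract T x)
  refine ⟨fun _ => x, P, fun l k => Q k l, fun _ l l' => ?_⟩
  change (1 : Matrix (Fin (contract T x).rank) (Fin (contract T x).rank) F) l l' = _
  rw [← hPQ]
  simp_rw [Matrix.mul_apply, contract, Matrix.of_apply, Finset.mul_sum, Finset.sum_mul]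
  rw [Finset.sum_comm, Finset.sum_comm (s := Finset.univ (α := ι1))]
  refine Finset.sum_congr rfl fun j _ => ?_
  rw [Finset.sum_comm]
  refine Finset.sum_congr rfl fun k _ => Finset.sum_congr rfl fun i _ => ?_
  ring

theorem Restricts.kron_kronPow {T : ι1 → ι2 → ι3 → F} {k l : ℕ} {S : κ1 → κ2 → κ3 → F}
    {μ1 μ2 μ3 : Type*} {S' : μ1 → μ2 → μ3 → F}
    (h : Restricts (kronPow T k) S) (h' : Restricts (kronPow T l) S') :
    Restricts (kronPow T (k + l)) (kron S S') := by
  obtain ⟨L1, L2, L3, hL⟩ := h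
  obtain ⟨L1', L2', L3', hL'⟩ := h'
  refine ⟨fun p x => L1 p.1 ((Fin.appendEquiv k l).symm x).1 *
      L1' p.2 ((Fin.appendEquiv k l).symm x).2,
    fun p x => L2 p.1 ((Fin.appendEquiv k l).symm x).1 *
      L2' p.2 ((Fin.appendEquiv k l).symm x).2,
    fun p x => L3 p.1 ((Fin.appendEquiv k l).symm x).1 *
      L3' p.2 ((Fin.appendEquiv k l).symm x).2, fun p q r => ?_⟩
  simp_rw [← (Fin.appendEquiv k l).sum_comp, Equiv.symm_apply_apply, Fintype.sum_prod_type]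
  rw [kron, hL, hL']
  simp_rw [Finset.sum_mul_sum]
  refine Finset.sum_congr rfl fun i _ => Finset.sum_congr rfl fun i' _ =>
    Finset.sum_congr rfl fun j _ => Finset.sum_congr rfl fun j' _ =>
    Finset.sum_congr rfl fun k _ => Finset.sum_congr rfl fun k' _ => ?_
  simp only [kronPow, Fin.appendEquiv, Equiv.coe_fn_mk, Fin.prod_univ_add, Fin.append_left,
    Fin.append_right]
  ring

theorem Restricts.le_card {T : ι1 → ι2 → ι3 → F} {r : ℕ} (h : Restricts T (unitTensor F r)) :
    r ≤ Fintype.card ι1 := by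
  obtain ⟨L1, L2, L3, hL⟩ := h
  have h1 : Matrix.of L1 * Matrix.of (fun i a => ∑ c, ∑ j, ∑ k, L2 a j * L3 c k * T i j k) =
      (1 : Matrix (Fin r) (Fin r) F) := by
    ext a b
    have h2 : ∑ c, unitTensor F r a b c = (1 : Matrix (Fin r) (Fin r) F) a b := by
      by_cases hab : a = b <;> simp [unitTensor, hab, Matrix.one_apply]
    rw [← h2, Matrix.mul_apply]
    simp_rw [hL, Matrix.of_apply, Finset.mul_sum, mul_assoc]
    exact Finset.sum_comm
  have h2 := Matrix.rank_mul_le_left (Matrix.of L1)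
    (Matrix.of (fun i a => ∑ c, ∑ j, ∑ k, L2 a j * L3 c k * T i j k))
  rw [h1, Matrix.rank_one, Fintype.card_fin] at h2
  exact h2.trans (Matrix.rank_le_card_width _)

theorem bddAbove_setOf_restricts (T : ι1 → ι2 → ι3 → F) :
    BddAbove {r : ℕ | Restricts T (unitTensor F r)} :=
  ⟨_, fun _ h => Restricts.le_card h⟩

theorem subrank_le_card (T : ι1 → ι2 → ι3 → F) : subrank T ≤ Fintype.card ι1 :=
  csSup_le' fun _ h => Restricts.le_card h

theorem subrank_rpow_le_asympSubrank (T : ι1 → ι2 → ι3 → F) {m : ℕ} (hm : m ≠ 0) :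
    (subrank (kronPow T m) : ℝ) ^ ((1 : ℝ) / m) ≤ asympSubrank T := by
  obtain ⟨m, rfl⟩ := Nat.exists_eq_succ_of_ne_zero hm
  have hbdd : BddAbove (Set.range fun m : ℕ =>
      (subrank (kronPow T (m + 1)) : ℝ) ^ ((1 : ℝ) / (m + 1))) := by
    refine ⟨Fintype.card ι1, ?_⟩
    rintro _ ⟨m, rfl⟩
    have h := subrank_le_card (kronPow T (m + 1))
    rw [Fintype.card_fun, Fintype.card_fin] at h
    calc (subrank (kronPow T (m + 1)) : ℝ) ^ ((1 : ℝ) / (m + 1))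
        ≤ ((Fintype.card ι1 : ℝ) ^ (m + 1)) ^ ((1 : ℝ) / (m + 1)) := by
          gcongr
          exact_mod_cast h
      _ = Fintype.card ι1 := by
          have := Real.pow_rpow_inv_natCast (x := (Fintype.card ι1 : ℝ)) (by positivity)
            (Nat.succ_ne_zero m)
          simpa using this
  simpa [asympSubrank] using le_ciSup hbdd m

theorem exists_rank_contract_max {α β γ : Type*} [Fintype α] [Fintype γ] (T : α → β → γ → F) :
    ∃ x, ∀ x', (contract T x').rank ≤ (contract T x).rank := by
  obtain ⟨x, hx⟩ := Nat.sSup_mem (Set.range_nonempty fun x => (contract T x).rank)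
    ⟨Fintype.card γ, by rintro _ ⟨x, rfl⟩; exact Matrix.rank_le_card_width _⟩
  refine ⟨x, fun x' => ?_⟩
  simp only at hx
  rw [hx]
  exact le_csSup ⟨Fintype.card γ, by rintro _ ⟨x, rfl⟩; exact Matrix.rank_le_card_width _⟩
    ⟨x', rfl⟩

/-- Three contractions combine to a matrix multiplication tensor, which restricts to a large unit
tensor. -/
theorem le_subrank_of_triangleFree (T : ι1 → ι2 → ι3 → F) {k r : ℕ} (x : (Fin k → ι1) → F)
    (y : (Fin k → ι2) → F) (z : (Fin k → ι3) → F)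
    (f : Fin r → Fin (contract (kronPow T k) x).rank)
    (g : Fin r → Fin (contract (rotate (kronPow T k)) y).rank)
    (h : Fin r → Fin (contract (rotate (rotate (kronPow T k))) z).rank)
    (H : TriangleFree f g h) : r ≤ subrank (kronPow T (k + k + k)) := by
  refine le_csSup (bddAbove_setOf_restricts _) ?_
  have h1 := restricts_of_contract (kronPow T k) x
  have h2 := (restricts_of_contract (rotate (kronPow T k)) y).of_rotate
  have h3 := (restricts_of_contract (rotate (rotate (kronPow T k))) z).of_rotate.of_rotate
  have h4 := ((h1.kron_kronPow h2).kron_kronPow h3).comp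
    (fun d => (((), g d), h d)) (fun d => ((f d, ()), h d)) (fun d => ((f d, g d), ()))
  change Restricts _ _
  convert h4 using 4 with d d' d''
  simp only [kron, unitTensor]
  by_cases hd : d = d' ∧ d' = d''
  · obtain ⟨rfl, rfl⟩ := hd
    simp
  · rw [if_neg hd]
    by_contra hne
    refine hd (H d d' d'' ?_ ?_ ?_) <;> by_contra hc <;> simp [hc] at hne

end Tensors

section Asymptotic

theorem flattening3_rotate_rotate_rank {ι1 ι2 ι3 : Type*} [Fintype ι1] [Fintype ι3]
    [Fintype ι2] (T : ι1 → ι2 → ι3 → F) :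
    (flattening3 (rotate (rotate T))).rank = (flattening2 T).rank :=
  (flattening2 T).rank_submatrix (Equiv.refl ι2) (Equiv.prodComm ι3 ι1)

theorem le_subrank_kronPow {n1 n2 n3 : ℕ} (T : Fin n1 → Fin n2 → Fin n3 → F) (hT : Concise T)
    (k : ℕ) :
    ((min (min n1 n2) n3 : ℕ) : ℝ) ^ k / 18 *
      Real.exp (-4 * √(Real.log (((max (max n1 n2) n3 : ℕ) : ℝ) ^ k))) ≤
      subrank (kronPow T (k + k + k)) := by
  obtain ⟨hT1, hT2, hT3⟩ := hT
  set N := min (min n1 n2) n3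
  set B := max (max n1 n2) n3
  obtain ⟨x, hx⟩ := exists_rank_contract_max (kronPow T k)
  obtain ⟨y, hy⟩ := exists_rank_contract_max (rotate (kronPow T k))
  obtain ⟨z, hz⟩ := exists_rank_contract_max (rotate (rotate (kronPow T k)))
  have hcard : ∀ {n : ℕ} {a b : ℕ}, N ≤ n → Fintype.card (Fin k → Fin n) ≤ 2 * a * b →
      (N : ℝ) ^ k ≤ 2 * a * b := fun hn h => by
    rw [Fintype.card_fun, Fintype.card_fin, Fintype.card_fin] at h
    exact_mod_cast (Nat.pow_le_pow_left hn k).trans h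
  have hwidth : ∀ {n m : ℕ} (M : Matrix (Fin k → Fin m) (Fin k → Fin n) F), n ≤ B →
      (M.rank : ℝ) ≤ (B : ℝ) ^ k := fun M hn => by
    have h := M.rank_le_card_width
    rw [Fintype.card_fun, Fintype.card_fin, Fintype.card_fin] at h
    exact_mod_cast h.trans (Nat.pow_le_pow_left hn k)
  have h12 := card_le_of_rank_contract_le _ (rank_flattening3_kronPow T hT3 k) hx hy
  have h23 := card_le_of_rank_contract_le (rotate (kronPow T k))
    (rank_flattening3_kronPow (rotate T) hT1 k) hy hz
  have h31 := card_le_of_rank_contract_le (rotate (rotate (kronPow T k)))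
    (rank_flattening3_kronPow (rotate (rotate T))
      ((flattening3_rotate_rotate_rank T).trans hT2) k) hz hx
  obtain ⟨r, f, g, h, H, hr⟩ := exists_triangleFree
    (hwidth (contract (kronPow T k) x) (by omega))
    (hwidth (contract (rotate (kronPow T k)) y) (by omega))
    (hwidth (contract (rotate (rotate (kronPow T k))) z) (by omega))
    (hcard (by omega) h12) (hcard (by omega) h23) (hcard (by omega) h31)
  exact hr.trans (by exact_mod_cast le_subrank_of_triangleFree T x y z f g h H)

theorem tendsto_rpow_mul_exp (L : ℝ) {N : ℝ} (hN : 0 < N) :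
    Filter.Tendsto (fun k : ℕ => (N ^ k / 18 * Real.exp (-4 * √(k * L))) ^ ((1 : ℝ) / (3 * k)))
      Filter.atTop (nhds (N ^ ((1 : ℝ) / 3))) := by
  have hlim : Filter.Tendsto (fun k : ℕ =>
      Real.exp (Real.log N / 3 - Real.log 18 / 3 * (k : ℝ)⁻¹ - 4 / 3 * √(L * (k : ℝ)⁻¹)))
      Filter.atTop (nhds (Real.exp (Real.log N / 3 - Real.log 18 / 3 * 0 - 4 / 3 * √(L * 0)))) := by
    have h := tendsto_inv_atTop_nhds_zero_nat (𝕜 := ℝ)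
    exact (Real.continuous_exp.tendsto _).comp ((tendsto_const_nhds.sub (h.const_mul _)).sub
      (((Real.continuous_sqrt.tendsto _).comp (h.const_mul L)).const_mul _))
  have hval : Real.exp (Real.log N / 3 - Real.log 18 / 3 * 0 - 4 / 3 * √(L * 0)) =
      N ^ ((1 : ℝ) / 3) := by
    rw [Real.rpow_def_of_pos hN]
    simp [div_eq_mul_inv]
  rw [hval] at hlim
  refine hlim.congr' ?_
  filter_upwards [Filter.eventually_gt_atTop 0] with k hk
  have hk' : (0 : ℝ) < k := by exact_mod_cast hk
  rw [Real.rpow_def_of_pos (by positivity), Real.log_mul (by positivity) (by positivity),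
    Real.log_exp, Real.log_div (by positivity) (by norm_num), Real.log_pow]
  have hs : √(L * (k : ℝ)⁻¹) = √(k * L) / k := by
    rw [show L * (k : ℝ)⁻¹ = (k * L) / (k : ℝ) ^ 2 by field_simp, Real.sqrt_div' _ (by positivity),
      Real.sqrt_sq hk'.le]
  rw [hs]
  congr 1
  field_simp
  ring

end Asymptotic

/-- Every concise tensor `T` of format `(n1, n2, n3)` over any field
has asymptotic subrank at least `(min {n1, n2, n3})^(1/3)`. -/
theorem asympSubrank_ge_cuberoot_min (F : Type*) [Field F] (n1 n2 n3 : ℕ)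
    (T : Fin n1 → Fin n2 → Fin n3 → F) (hT : Concise T) :
    ((min (min n1 n2) n3 : ℕ) : ℝ) ^ ((1 : ℝ) / 3) ≤ asympSubrank T := by
  obtain h0 | hpos := Nat.eq_zero_or_pos (min (min n1 n2) n3)
  · rw [h0, Nat.cast_zero, Real.zero_rpow (by norm_num)]
    exact Real.iSup_nonneg fun m => by positivity
  refine le_of_tendsto (tendsto_rpow_mul_exp (Real.log (max (max n1 n2) n3 : ℕ))
    (Nat.cast_pos.2 hpos)) ?_
  filter_upwards [Filter.eventually_gt_atTop 0] with k hk
  refine le_trans ?_ (subrank_rpow_le_asympSubrank T (m := k + k + k) (by omega))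
  have h := le_subrank_kronPow T hT k
  rw [Real.log_pow] at h
  have hk3 : ((k + k + k : ℕ) : ℝ) = 3 * k := by
    push_cast
    ring
  rw [hk3]
  gcongr

end Paper
end

section
/- Let T ∈ F^{n1} ⊗ F^{n2} ⊗ F^{n3} be a concise tensor over a field F, let i, j, k ∈ {1,2,3} be distinct, and suppose |F| > n_k. Then Q_i(T) · Q_j(T) ≥ n_k. -/
open scoped BigOperators

namespace Paper

variable {F : Type*} [Field F]

section BilinearMaps

variable {U V W : Type*} [AddCommGroup U] [Module F U] [AddCommGroup V] [Module F V]
  [AddCommGroup W] [Module F W]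

open Module

/-- If `A` has maximal rank among the maps `s • A - X`, then `X` sends the kernel of `A` into
the range of `A`, provided the field is large enough. -/
theorem mem_range_of_finrank_range_le [FiniteDimensional F W]
    (hF : (finrank F W : Cardinal) < Cardinal.mk F) (A X : V →ₗ[F] W)
    (hmax : ∀ s : F, finrank F (s • A - X).range ≤ finrank F A.range)
    {v : V} (hv : A v = 0) : X v ∈ A.range := by
  by_contra hXv
  obtain ⟨σ, hσ⟩ := A.rangeRestrict.exists_rightInverse_of_surjective A.range_rangeRestrict
  have hAσ (k : A.range) : A (σ k) = k := congrArg Subtype.val (LinearMap.congr_fun hσ k)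
  let emb : (A.range × F) →ₗ[F] W := A.range.subtype.coprod (LinearMap.toSpanSingleton F W (X v))
  have hemb : emb.ker = ⊥ := by
    rw [LinearMap.ker_eq_bot']
    rintro ⟨k, c⟩ h
    have h' : (k : W) + c • X v = 0 := by simpa [emb] using h
    have hc : c = 0 := by
      by_contra hc
      apply hXv
      have : c • X v ∈ A.range := by
        rw [eq_neg_of_add_eq_zero_right h']
        exact neg_mem k.2
      exact (Submodule.smul_mem_iff _ hc).1 this
    subst hc
    simpa using h'
  obtain ⟨φ, hφ⟩ := emb.exists_leftInverse_of_injective hemb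
  have hφ' (p) : φ (emb p) = p := LinearMap.congr_fun hφ p
  have hφK (k : A.range) : φ k = (k, 0) := by simpa [emb] using hφ' (k, 0)
  have hφX : φ (X v) = (0, 1) := by simpa [emb] using hφ' (0, 1)
  have hrank : finrank F (A.range × F) = finrank F A.range + 1 := by simp
  have hle : finrank F (A.range × F) ≤ finrank F W :=
    LinearMap.finrank_le_finrank_of_injective (LinearMap.ker_eq_bot.1 hemb)
  let N : End F (A.range × F) := φ ∘ₗ X ∘ₗ σ ∘ₗ LinearMap.fst F _ _
  obtain ⟨s, hs⟩ := Polynomial.exists_eval_ne_zero_of_natDegree_lt_card N.charpoly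
    N.charpoly_monic.ne_zero (by
      rw [LinearMap.charpoly_natDegree]
      exact lt_of_le_of_lt (by exact_mod_cast hle) hF)
  have hinj : (s • LinearMap.id - N).ker = ⊥ := by
    rw [LinearMap.ker_eq_bot']
    intro p hp
    by_contra hp0
    refine hs ((End.hasEigenvalue_iff_isRoot_charpoly N s).1
      (End.hasEigenvalue_of_hasEigenvector (x := p) ⟨?_, hp0⟩))
    rw [End.mem_eigenspace_iff]
    exact (sub_eq_zero.1 hp).symm
  let τ : (A.range × F) →ₗ[F] V := σ.coprod (LinearMap.toSpanSingleton F V (-s • v))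
  have hcomp : φ ∘ₗ (s • A - X) ∘ₗ τ = s • LinearMap.id - N := by
    refine LinearMap.ext fun ⟨k, c⟩ => ?_
    simp only [τ, N, LinearMap.comp_apply, LinearMap.coprod_apply, LinearMap.sub_apply,
      LinearMap.smul_apply, LinearMap.toSpanSingleton_apply, map_add, map_smul, map_sub, hAσ,
      hφK, hφX, hv, LinearMap.fst_apply, LinearMap.id_apply]
    ext <;> simp [mul_comm, neg_add_eq_sub]
  have hlast := LinearMap.finrank_range_of_inj (LinearMap.ker_eq_bot.1 hinj)
  rw [← hcomp, LinearMap.range_comp] at hlast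
  have h1 := Submodule.finrank_map_le φ ((s • A - X) ∘ₗ τ).range
  have h2 := Submodule.finrank_mono (LinearMap.range_comp_le_range τ (s • A - X))
  have h3 := hmax s
  omega

theorem finrank_sup_biSup_le [FiniteDimensional F W] {ι : Type*} (K : Submodule F W)
    (S : ι → Submodule F W) (hS : ∀ i, K ⊓ S i ≠ ⊥) (s : Finset ι) :
    finrank F ↥(K ⊔ ⨆ i ∈ s, S i) ≤ finrank F K + ∑ i ∈ s, (finrank F (S i) - 1) := by
  classical
  induction s using Finset.induction_on with
  | empty =>
    have h : K ⊔ ⨆ i ∈ (∅ : Finset ι), S i = K := by simp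
    rw [h, Finset.sum_empty, add_zero]
  | insert a s ha ih =>
    rw [Finset.sum_insert ha, Finset.iSup_insert, sup_comm (S a), ← sup_assoc]
    have hdim := Submodule.finrank_sup_add_finrank_inf_eq (K ⊔ ⨆ i ∈ s, S i) (S a)
    have hpos : 0 < finrank F ↥((K ⊔ ⨆ i ∈ s, S i) ⊓ S a) := by
      rw [Nat.pos_iff_ne_zero, Ne, Submodule.finrank_eq_zero]
      exact fun h => hS a (le_bot_iff.1 (h ▸ inf_le_inf_right _ le_sup_left))
    omega

/-- A bilinear map whose values span `W`, and whose partial evaluations have rank at most `p`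
and `q` respectively, satisfies `dim W ≤ p * q` over a large enough field. -/
theorem finrank_le_mul_of_bilinear [FiniteDimensional F W]
    (hF : (finrank F W : Cardinal) < Cardinal.mk F) (B : U →ₗ[F] V →ₗ[F] W)
    (hB : ∀ S : Submodule F W, (∀ u v, B u v ∈ S) → S = ⊤) {p q : ℕ}
    (hp : ∀ u, finrank F (B u).range ≤ p) (hq : ∀ v, finrank F (B.flip v).range ≤ q) :
    finrank F W ≤ p * q := by
  obtain ⟨u₀, hu₀⟩ : ∃ u₀, ∀ u, finrank F (B u).range ≤ finrank F (B u₀).range := by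
    have hfin : (Set.range fun u => finrank F (B u).range).Finite :=
      (Set.finite_Iic p).subset (by rintro _ ⟨u, rfl⟩; exact hp u)
    obtain ⟨_, ⟨u₀, rfl⟩, h⟩ := Set.exists_max_image _ id hfin (Set.range_nonempty _)
    exact ⟨u₀, fun u => h _ ⟨u, rfl⟩⟩
  set A := B u₀ with hA
  obtain ⟨σ, hσ⟩ := A.rangeRestrict.exists_rightInverse_of_surjective A.range_rangeRestrict
  have hAσ (k : A.range) : A (σ k) = k := congrArg Subtype.val (LinearMap.congr_fun hσ k)
  let b := finBasis F A.range
  have hbne (i) : A (σ (b i)) ≠ 0 := by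
    rw [hAσ]
    simpa using b.ne_zero i
  have htop : A.range ⊔ ⨆ i ∈ Finset.univ, (B.flip (σ (b i))).range = ⊤ := by
    refine hB _ fun u v => ?_
    have hker : A (v - σ (A.rangeRestrict v)) = 0 := by
      rw [map_sub, hAσ]
      simp
    have h1 : B u (v - σ (A.rangeRestrict v)) ∈ A.range :=
      mem_range_of_finrank_range_le hF A (B u)
        (fun s => by rw [hA, ← map_smul, ← map_sub]; exact hu₀ (s • u₀ - u)) hker
    have h2 : B u (σ (A.rangeRestrict v)) ∈
        ⨆ i ∈ Finset.univ, (B.flip (σ (b i))).range := by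
      rw [← b.sum_repr (A.rangeRestrict v)]
      simp only [map_sum, map_smul]
      refine Submodule.sum_mem _ fun i hi => Submodule.smul_mem _ _ ?_
      exact Submodule.mem_iSup_of_mem i (Submodule.mem_iSup_of_mem hi ⟨u, rfl⟩)
    have h3 := Submodule.add_mem_sup h1 h2
    rwa [← map_add, sub_add_cancel] at h3
  have hinf (i) : A.range ⊓ (B.flip (σ (b i))).range ≠ ⊥ :=
    (Submodule.ne_bot_iff _).2 ⟨A (σ (b i)), ⟨⟨_, rfl⟩, ⟨u₀, rfl⟩⟩, hbne i⟩
  have hmain := finrank_sup_biSup_le A.range _ hinf Finset.univ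
  rw [htop, finrank_top] at hmain
  have hsum : ∑ i, (finrank F (B.flip (σ (b i))).range - 1) ≤ finrank F A.range * (q - 1) := by
    refine (Finset.sum_le_card_nsmul _ _ (q - 1) fun i _ => Nat.sub_le_sub_right (hq _) 1).trans ?_
    simp
  refine le_trans ?_ (Nat.mul_le_mul_right q (hp u₀))
  rw [← hA]
  rcases Nat.eq_zero_or_pos (finrank F A.range) with h0 | hpos
  · have h0' := h0 ▸ Nat.zero_mul (q - 1)
    omega
  · have hq1 : 1 ≤ q := by
      refine le_trans ?_ (hq (σ (b ⟨0, hpos⟩)))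
      rw [Nat.one_le_iff_ne_zero, Ne, Submodule.finrank_eq_zero]
      exact fun h => hinf ⟨0, hpos⟩ (by rw [h, inf_bot_eq])
    obtain ⟨q, rfl⟩ := Nat.exists_eq_add_of_le' hq1
    rw [Nat.add_sub_cancel] at hsum
    rw [mul_add_one]
    omega

end BilinearMaps

section Arrays

variable {α β γ : Type*}

/-- The bilinear map `(u, v) ↦ ∑ a b, u a * v b * T a b ·` attached to a coefficient array. -/
noncomputable def contraction [Fintype α] [Fintype β] (T : α → β → γ → F) :
    (α → F) →ₗ[F] (β → F) →ₗ[F] (γ → F) :=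
  LinearMap.mk₂ F (fun u v c => ∑ a, ∑ b, u a * v b * T a b c)
    (fun u u' v => by ext c; simp [add_mul, Finset.sum_add_distrib])
    (fun r u v => by ext c; simp [Finset.mul_sum, mul_assoc])
    (fun u v v' => by ext c; simp [mul_add, add_mul, Finset.sum_add_distrib])
    (fun r u v => by ext c; simp [Finset.mul_sum, mul_assoc, mul_left_comm])

theorem contraction_apply [Fintype α] [Fintype β] (T : α → β → γ → F)
    (u : α → F) (v : β → F) (c : γ) :
    contraction T u v c = ∑ a, ∑ b, u a * v b * T a b c := rfl

theorem contraction_flip [Fintype α] [Fintype β] (T : α → β → γ → F) :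
    (contraction T).flip = contraction fun b a c => T a b c := by
  refine LinearMap.ext fun v => LinearMap.ext fun u => funext fun c => ?_
  rw [LinearMap.flip_apply, contraction_apply, contraction_apply, Finset.sum_comm]
  exact Finset.sum_congr rfl fun _ _ => Finset.sum_congr rfl fun _ _ => by rw [mul_comm (u _)]

theorem rank_le_maxrank [Fintype β] {𝒜 : Submodule F (Matrix α β F)} {A : Matrix α β F}
    (hA : A ∈ 𝒜) :
    A.rank ≤ maxrank 𝒜 :=
  le_csSup ⟨Fintype.card β, by rintro _ ⟨A, -, rfl⟩; exact A.rank_le_card_width⟩ ⟨A, hA, rfl⟩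

theorem maxrank_span_range_transpose [Fintype α] [Fintype β] (M : γ → Matrix α β F) :
    maxrank (Submodule.span F (Set.range fun c => (M c).transpose)) =
      maxrank (Submodule.span F (Set.range M)) := by
  have hmap : Submodule.span F (Set.range fun c => (M c).transpose) =
      (Submodule.span F (Set.range M)).map (Matrix.transposeLinearEquiv α β F F).toLinearMap := by
    rw [Submodule.map_span, ← Set.range_comp]
    rfl
  unfold maxrank
  congr 1
  ext r
  simp only [hmap, Submodule.mem_map, Set.mem_ofPred_eq, exists_exists_and_eq_and]
  simp [Matrix.rank_transpose]

theorem finrank_range_contraction_le [Fintype α] [Fintype β] [Fintype γ]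
    (T : α → β → γ → F) (u : α → F) :
    Module.finrank F (contraction T u).range ≤
      maxrank (Submodule.span F (Set.range fun a => Matrix.of (T a))) := by
  classical
  rw [← maxrank_span_range_transpose]
  have heq : contraction T u = (∑ a, u a • (Matrix.of (T a)).transpose).mulVecLin := by
    refine LinearMap.ext fun v => funext fun c => ?_
    simp only [contraction_apply, Matrix.mulVecLin_apply, Matrix.mulVec, dotProduct,
      Matrix.sum_apply, Matrix.smul_apply, Matrix.transpose_apply, Matrix.of_apply, smul_eq_mul,
      Finset.sum_mul]
    rw [Finset.sum_comm]
    exact Finset.sum_congr rfl fun _ _ => Finset.sum_congr rfl fun _ _ => by ring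
  rw [heq]
  exact rank_le_maxrank (Submodule.sum_mem _ fun a _ =>
    Submodule.smul_mem _ _ (Submodule.subset_span ⟨a, rfl⟩))

theorem eq_top_of_contraction_mem [Fintype α] [Fintype β] [Fintype γ] {T : α → β → γ → F}
    (hT : (flattening3 T).rank = Fintype.card γ) (S : Submodule F (γ → F))
    (hS : ∀ u v, contraction T u v ∈ S) : S = ⊤ := by
  classical
  rw [Matrix.rank_eq_finrank_span_cols] at hT
  refine top_le_iff.1 ?_
  rw [← Submodule.eq_top_of_finrank_eq (hT.trans (Module.finrank_fintype_fun_eq_card F).symm),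
    Submodule.span_le]
  rintro _ ⟨⟨a, b⟩, rfl⟩
  have hcol : (flattening3 T).col (a, b) = contraction T (Pi.single a 1) (Pi.single b 1) := by
    ext c
    simp [contraction_apply, flattening3, Pi.single_apply, Matrix.col]
  rw [hcol]
  exact hS _ _

/-- The product of the max-ranks of the slice spaces along the first two directions bounds the
dimension of the third. -/
theorem card_le_maxrank_mul_maxrank [Fintype α] [Fintype β] [Fintype γ] {T : α → β → γ → F}
    (hF : (Fintype.card γ : Cardinal) < Cardinal.mk F)
    (hT : (flattening3 T).rank = Fintype.card γ) :
    Fintype.card γ ≤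
      maxrank (Submodule.span F (Set.range fun a => Matrix.of (T a))) *
      maxrank (Submodule.span F (Set.range fun b => Matrix.of fun a c => T a b c)) := by
  have h := finrank_le_mul_of_bilinear (by rwa [Module.finrank_fintype_fun_eq_card])
    (contraction T) (eq_top_of_contraction_mem hT) (finrank_range_contraction_le T)
    (fun v => by
      rw [contraction_flip]
      exact finrank_range_contraction_le _ v)
  rwa [Module.finrank_fintype_fun_eq_card] at h

end Arrays

section Directions

variable {n1 n2 n3 : ℕ} {T : Fin n1 → Fin n2 → Fin n3 → F}

theorem le_Q1_mul_Q2 (hT : Concise T) (hF : (n3 : Cardinal) < Cardinal.mk F) :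
    n3 ≤ Q1 T * Q2 T := by
  have h := card_le_maxrank_mul_maxrank (by simpa using hF) hT.2.2
  rwa [Fintype.card_fin] at h

theorem le_Q1_mul_Q3 (hT : Concise T) (hF : (n2 : Cardinal) < Cardinal.mk F) :
    n2 ≤ Q1 T * Q3 T := by
  have h := card_le_maxrank_mul_maxrank (T := fun a c b => T a b c) (by simpa using hF) hT.2.1
  rw [Fintype.card_fin] at h
  exact h.trans_eq (congrArg (· * _)
    (maxrank_span_range_transpose fun a => Matrix.of fun b c => T a b c))

theorem le_Q2_mul_Q3 (hT : Concise T) (hF : (n1 : Cardinal) < Cardinal.mk F) :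
    n1 ≤ Q2 T * Q3 T := by
  have h := card_le_maxrank_mul_maxrank (T := fun b c a => T a b c) (by simpa using hF) hT.1
  rw [Fintype.card_fin] at h
  exact h.trans_eq (congrArg₂ (· * ·)
    (maxrank_span_range_transpose fun b => Matrix.of fun a c => T a b c)
    (maxrank_span_range_transpose fun c => Matrix.of fun a b => T a b c))

end Directions

/-- For a concise tensor `T` of format `(n1, n2, n3)`, distinct
`i, j, k ∈ {1,2,3}` and `|F| > n_k`, the product of max-ranks `Q_i(T) · Q_j(T)`
is at least `n_k`. -/
theorem maxrank_product_ge (F : Type*) [Field F] (n1 n2 n3 : ℕ)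
    (T : Fin n1 → Fin n2 → Fin n3 → F) (hT : Concise T)
    (i j k : Fin 3) (hij : i ≠ j) (hik : i ≠ k) (hjk : j ≠ k)
    (hF : ((![n1, n2, n3] k : ℕ) : Cardinal) < Cardinal.mk F) :
    ![n1, n2, n3] k ≤ ![Q1 T, Q2 T, Q3 T] i * ![Q1 T, Q2 T, Q3 T] j := by
  fin_cases i <;> fin_cases j <;> fin_cases k <;>
    first
    | exact absurd rfl hij
    | exact absurd rfl hik
    | exact absurd rfl hjk
    | exact le_Q1_mul_Q2 hT hF
    | exact le_Q1_mul_Q3 hT hF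
    | exact le_Q2_mul_Q3 hT hF
    | exact (le_Q1_mul_Q2 hT hF).trans_eq (Nat.mul_comm _ _)
    | exact (le_Q1_mul_Q3 hT hF).trans_eq (Nat.mul_comm _ _)
    | exact (le_Q2_mul_Q3 hT hF).trans_eq (Nat.mul_comm _ _)

end Paper
end
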